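/- arXiv:2201.07107 — 2 statements merged into one kernel-verified Lean document; each statement's English description precedes it below -/
import Mathlib

section
/- Let M, N, Q be positive integers with M < N and gcd(M, N) = 1, and set P = N + 2M − 1. If 2·(M·N + M − 1) > Q − 1, then (P : ℝ) > 2·√(Q + 1) − 2. -/
/-- Arithmetic core of Theorem 2: for co-prime `M < N` and `Q` targets,
condition C4, `2(MN + M − 1) > Q − 1`, forces the number of physical sensors
`P = N + 2M − 1` to exceed `2√(Q+1) − 2`. -/
theorem stmt_12 (M N Q : ℕ) (hM : 0 < M) (hN : 0 < N) (hQ : 0 < Q)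
    (hMN : M < N) (hcop : Nat.Coprime M N)
    (hC4 : 2 * (M * N + M - 1) > Q - 1) :
    ((N + 2 * M - 1 : ℕ) : ℝ) > 2 * Real.sqrt (Q + 1) - 2 := by
  have hMN_pos : 0 < M * N := Nat.mul_pos hM hN
  have hlt : Q + 1 < 2 * (M * N) + 2 * M := by omega
  have hltR : (Q : ℝ) + 1 < 2 * (M * N) + 2 * M := by exact_mod_cast hlt
  have hsqrt : Real.sqrt (Q + 1) < (2 * M + N + 1) / 2 := by
    rw [Real.sqrt_lt' (by positivity)]
    nlinarith [sq_nonneg (2 * (M : ℝ) - (N + 1))]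
  rw [Nat.cast_sub (by omega)]
  push_cast
  linarith
end

section
/- Let M and N be positive integers with M < N and gcd(M, N) = 1. Define the set of integers S = {M·i : 0 ≤ i ≤ N−1} ∪ {N·j : 1 ≤ j ≤ 2M−1}. Then for every integer n with |n| ≤ M·N + M − 1, there exist s₁, s₂ ∈ S such that n = s₁ − s₂. -/
/-- Every integer `n` with `0 ≤ n ≤ MN + M - 1` has a representation `n = N * j - M * i` with
`0 ≤ i ≤ N - 1` and `0 ≤ j ≤ 2 * M - 1`, when `M` and `N` are coprime and positive. -/
theorem IsCoprime.exists_eq_mul_sub_mul {M N : ℤ} (hcop : IsCoprime M N) (hM : 0 < M) (hN : 0 < N)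
    {n : ℤ} (h0 : 0 ≤ n) (hn : n ≤ M * N + M - 1) :
    ∃ i j : ℤ, (0 ≤ i ∧ i ≤ N - 1) ∧ (0 ≤ j ∧ j ≤ 2 * M - 1) ∧ n = N * j - M * i := by
  obtain ⟨a, b, hab⟩ := hcop
  have hi0 : 0 ≤ (-n * a) % N := Int.emod_nonneg _ hN.ne'
  have hi1 : (-n * a) % N < N := Int.emod_lt_of_pos _ hN
  have hdiv := Int.emod_add_mul_ediv (-n * a) N
  generalize (-n * a) % N = i at *
  generalize (-n * a) / N = q at *
  have key : N * (n * b - M * q) = n + M * i := by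
    linear_combination n * hab - M * hdiv
  generalize n * b - M * q = j at *
  refine ⟨i, j, ⟨hi0, by lia⟩, ⟨?_, ?_⟩, by lia⟩
  · exact nonneg_of_mul_nonneg_right (key ▸ by positivity) hN
  · have : j < 2 * M := lt_of_mul_lt_mul_left (by nlinarith) hN.le
    lia

/-- Contiguity of the co-prime difference coarray: for co-prime
`M < N`, every integer lag `n` with `|n| ≤ MN + M − 1` is a difference of two elements of
the sensor-position set `S = {M·i : 0 ≤ i ≤ N−1} ∪ {N·j : 1 ≤ j ≤ 2M−1}`. -/
theorem stmt_13 (M N : ℕ) (hM : 0 < M) (hMN : M < N) (hcop : Nat.Coprime M N)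
    (S : Set ℤ)
    (hS : S = {x : ℤ | (∃ i : ℤ, 0 ≤ i ∧ i ≤ (N : ℤ) - 1 ∧ x = (M : ℤ) * i) ∨
                       (∃ j : ℤ, 1 ≤ j ∧ j ≤ 2 * (M : ℤ) - 1 ∧ x = (N : ℤ) * j)})
    (n : ℤ) (hn : |n| ≤ (M : ℤ) * N + M - 1) :
    ∃ s₁ ∈ S, ∃ s₂ ∈ S, n = s₁ - s₂ := by
  have hM' : (0 : ℤ) < M := by exact_mod_cast hM
  have hN' : (0 : ℤ) < N := by exact_mod_cast hM.trans hMN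
  obtain ⟨i, j, ⟨hi0, hi1⟩, ⟨hj0, hj1⟩, hij⟩ :=
    (Nat.isCoprime_iff_coprime.mpr hcop).exists_eq_mul_sub_mul hM' hN' (abs_nonneg n) hn
  have hi : (M : ℤ) * i ∈ S := by
    rw [hS]
    exact Or.inl ⟨i, hi0, hi1, rfl⟩
  have hj : (N : ℤ) * j ∈ S := by
    rw [hS]
    rcases hj0.eq_or_lt with rfl | hj0
    · exact Or.inl ⟨0, le_rfl, by lia, by simp⟩
    · exact Or.inr ⟨j, hj0, hj1, rfl⟩
  rcases abs_choice n with h | h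
  · exact ⟨_, hj, _, hi, by lia⟩
  · exact ⟨_, hi, _, hj, by lia⟩
end
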